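/- Let U be a valuation domain with fraction field K and let X be an indeterminate. Then V = U + X·K[X]_{(X)} is a valuation domain; moreover, if U has finite Krull dimension n then V has Krull dimension n + 1. -/

import Mathlib

open Polynomial

/-- The multiplicative set of polynomials over `K` with nonzero constant term;
localizing `K[X]` at this set gives `K[X]_{(X)}`. -/
def constUnit (K : Type*) [Field K] : Submonoid (Polynomial K) where
  carrier := {p | p.coeff 0 ≠ 0}
  one_mem' := by simp
  mul_mem' := by
    intro a b ha hb
    simpa [Polynomial.mul_coeff_zero] using mul_ne_zero ha hb

instance (K : Type*) [Field K] : IsDomain (Localization (constUnit K)) :=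
  IsLocalization.isDomain_localization
    (fun p hp => mem_nonZeroDivisors_of_ne_zero (fun h => hp (by simp [h])))

/-- Evaluation of an element of `K[X]_{(X)}` at `0`, i.e. its constant term. -/
noncomputable def constTerm (K : Type*) [Field K] : Localization (constUnit K) →+* K :=
  IsLocalization.lift (M := constUnit K) (g := Polynomial.constantCoeff)
    (fun y => isUnit_iff_ne_zero.mpr y.2)

/-- The ring `V = U + X·K[X]_{(X)}`: the subring of `K[X]_{(X)}` of elements whose
constant term lies in `U`. -/
noncomputable def Vring (K : Type*) [Field K] (U : Type*) [CommRing U] [Algebra U K] :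
    Subring (Localization (constUnit K)) :=
  Subring.comap (constTerm K) (algebraMap U K).range

theorem constTerm_alg (K : Type*) [Field K] (p : Polynomial K) :
    constTerm K (algebraMap _ _ p) = p.coeff 0 := by
  simp [constTerm, IsLocalization.lift_eq]

theorem constTerm_surj (K : Type*) [Field K] (a : K) : ∃ x, constTerm K x = a :=
  ⟨algebraMap _ _ (Polynomial.C a), by simp [constTerm_alg]⟩

theorem loc_struct (K : Type*) [Field K] (x : Localization (constUnit K)) (hx : x ≠ 0) :
    ∃ (k : ℕ) (u : Localization (constUnit K)), IsUnit u ∧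
      x = (algebraMap (Polynomial K) _ Polynomial.X) ^ k * u := by
  obtain ⟨⟨a, s⟩, h⟩ := IsLocalization.surj (constUnit K) x
  have hs : IsUnit (algebraMap (Polynomial K) (Localization (constUnit K)) s) :=
    IsLocalization.map_units _ s
  have ha : a ≠ 0 := by
    rintro rfl
    simp only [map_zero] at h
    exact hx ((hs.mul_left_eq_zero).1 h)
  have hf : FiniteMultiplicity (Polynomial.X : Polynomial K) a :=
    FiniteMultiplicity.of_prime_left Polynomial.prime_X ha
  obtain ⟨q, hq, hnd⟩ := hf.exists_eq_pow_mul_and_not_dvd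
  have hq' : q ∈ constUnit K := fun h0 => hnd (Polynomial.X_dvd_iff.2 h0)
  have hqu : IsUnit (algebraMap (Polynomial K) (Localization (constUnit K)) q) :=
    IsLocalization.map_units _ (⟨q, hq'⟩ : constUnit K)
  obtain ⟨v, hv⟩ := hs
  refine ⟨multiplicity Polynomial.X a, _, hqu.mul (v⁻¹).isUnit, ?_⟩
  simp only at h
  rw [← mul_assoc, ← map_pow, ← map_mul, ← hq, ← h, ← hv, Units.mul_inv_cancel_right]

theorem loc_unit (K : Type*) [Field K] (x : Localization (constUnit K))
    (hx : constTerm K x ≠ 0) : IsUnit x := by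
  obtain ⟨k, u, hu, rfl⟩ := loc_struct K x (by rintro rfl; simp at hx)
  rcases k with _ | k
  · simpa using hu
  · simp [constTerm_alg] at hx

theorem loc_ker (K : Type*) [Field K] (x : Localization (constUnit K))
    (hx : constTerm K x = 0) : ∃ t, x = algebraMap (Polynomial K) _ Polynomial.X * t := by
  by_cases h0 : x = 0
  · exact ⟨0, by simp [h0]⟩
  obtain ⟨k, u, hu, rfl⟩ := loc_struct K x h0
  rcases k with _ | k
  · have := (hu.map (constTerm K)).ne_zero
    simp at hx
    exact absurd hx this
  · exact ⟨_, by rw [pow_succ']; exact mul_assoc _ _ _⟩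

theorem loc_total (K : Type*) [Field K] (x y : Localization (constUnit K)) :
    x ∣ y ∨ y ∣ x := by
  by_cases hx : x = 0
  · right; simp [hx]
  by_cases hy : y = 0
  · left; simp [hy]
  obtain ⟨k, u, hu, rfl⟩ := loc_struct K x hx
  obtain ⟨l, v, hv, rfl⟩ := loc_struct K y hy
  rcases le_total k l with h | h
  · left
    rw [hu.mul_right_dvd]
    exact (pow_dvd_pow _ h).mul_right _
  · right
    rw [hv.mul_right_dvd]
    exact (pow_dvd_pow _ h).mul_right _

theorem loc_pow (K : Type*) [Field K] (p : Localization (constUnit K)) (hp : p ≠ 0) :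
    ∃ k : ℕ, ∀ m, constTerm K m = 0 → p ∣ m ^ k := by
  obtain ⟨k, u, hu, rfl⟩ := loc_struct K p hp
  refine ⟨k, fun m hm => ?_⟩
  obtain ⟨t, rfl⟩ := loc_ker K m hm
  rw [hu.mul_right_dvd, mul_pow]
  exact dvd_mul_right _ _

theorem V_dvd_aux (K : Type*) [Field K] (U : Type*) [CommRing U] [IsDomain U]
    [ValuationRing U] [Algebra U K] [IsFractionRing U K] (a b : Vring K U)
    (h : (a : Localization (constUnit K)) ∣ b) : a ∣ b ∨ b ∣ a := by
  obtain ⟨r, hr⟩ := h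
  by_cases hrU : constTerm K r ∈ (algebraMap U K).range
  · left
    exact ⟨⟨r, hrU⟩, Subtype.ext hr⟩
  · right
    have h0 : constTerm K r ≠ 0 := fun h => hrU (h ▸ zero_mem _)
    obtain ⟨v, rfl⟩ := loc_unit K r h0
    have hi : constTerm K (↑v⁻¹ : Localization (constUnit K)) = (constTerm K v)⁻¹ := by
      apply eq_inv_of_mul_eq_one_left
      rw [← map_mul]; simp
    refine ⟨⟨(↑v⁻¹ : Localization (constUnit K)), ?_⟩, Subtype.ext ?_⟩
    · change constTerm K _ ∈ (algebraMap U K).range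
      rw [hi]
      rcases ValuationRing.isInteger_or_isInteger U (constTerm K v) with h | h
      · exact absurd h hrU
      · exact h
    · simp [hr]

theorem V_val (K : Type*) [Field K] (U : Type*) [CommRing U] [IsDomain U]
    [ValuationRing U] [Algebra U K] [IsFractionRing U K] : ValuationRing (Vring K U) := by
  rw [ValuationRing.iff_dvd_total]
  refine ⟨fun a b => ?_⟩
  rcases loc_total K (a : Localization (constUnit K)) b with h | h
  · exact V_dvd_aux K U a b h
  · exact (V_dvd_aux K U b a h).symm

/-- The constant term map from `V` onto the image of `U` in `K`. -/
noncomputable def Vmap (K : Type*) [Field K] (U : Type*) [CommRing U] [Algebra U K] :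
    Vring K U →+* (algebraMap U K).range :=
  ((constTerm K).comp (Vring K U).subtype).codRestrict _ (fun x => x.2)

theorem Vmap_surj (K : Type*) [Field K] (U : Type*) [CommRing U] [Algebra U K] :
    Function.Surjective (Vmap K U) := by
  rintro ⟨a, ha⟩
  obtain ⟨x, rfl⟩ := constTerm_surj K a
  exact ⟨⟨x, ha⟩, rfl⟩

theorem V_prime (K : Type*) [Field K] (U : Type*) [CommRing U] [Algebra U K]
    (P : Ideal (Vring K U)) [P.IsPrime] (hP : P ≠ ⊥) : RingHom.ker (Vmap K U) ≤ P := by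
  obtain ⟨p, hpP, hp0⟩ := Submodule.exists_mem_ne_zero_of_ne_bot hP
  obtain ⟨k, hk⟩ := loc_pow K (p : Localization (constUnit K)) (by simpa using hp0)
  intro m hm
  have hm0 : constTerm K m = 0 := congrArg Subtype.val hm
  obtain ⟨s, hs⟩ := hk m hm0
  have hmem : s * m ∈ Vring K U := by
    change constTerm K _ ∈ (algebraMap U K).range
    rw [map_mul, hm0, mul_zero]; exact zero_mem _
  have : m ^ (k + 1) = p * ⟨s * m, hmem⟩ := by
    apply Subtype.ext
    simp [pow_succ, hs, mul_assoc]
  exact Ideal.IsPrime.mem_of_pow_mem ‹_› (k + 1) (this ▸ P.mul_mem_right _ hpP)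

theorem V_ker_ne (K : Type*) [Field K] (U : Type*) [CommRing U] [Algebra U K] :
    ∃ x ∈ RingHom.ker (Vmap K U), x ≠ 0 := by
  have h0 : constTerm K (algebraMap _ _ (Polynomial.X : Polynomial K)) = 0 := by
    simp [constTerm_alg]
  refine ⟨⟨algebraMap _ _ (Polynomial.X : Polynomial K), ?_⟩, ?_, ?_⟩
  · change constTerm K _ ∈ (algebraMap U K).range
    rw [h0]; exact zero_mem _
  · exact Subtype.ext h0
  · intro h
    have h1 := congrArg Subtype.val h
    have hinj : Function.Injective (algebraMap (Polynomial K) (Localization (constUnit K))) :=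
      IsLocalization.injective (M := constUnit K) _
        (fun p hp => mem_nonZeroDivisors_of_ne_zero (fun h => hp (by simp [h])))
    exact Polynomial.X_ne_zero (hinj (h1.trans (map_zero _).symm))

/-- The map of spectra sending the bottom to the zero ideal. -/
noncomputable def specMap (K : Type*) [Field K] (U : Type*) [CommRing U] [Algebra U K] :
    WithBot (PrimeSpectrum (algebraMap U K).range) → PrimeSpectrum (Vring K U)
  | ⊥ => ⟨⊥, Ideal.isPrime_bot⟩
  | (P : PrimeSpectrum (algebraMap U K).range) => PrimeSpectrum.comap (Vmap K U) P

theorem specMap_le (K : Type*) [Field K] (U : Type*) [CommRing U] [Algebra U K]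
    (a b : WithBot (PrimeSpectrum (algebraMap U K).range)) :
    specMap K U a ≤ specMap K U b ↔ a ≤ b := by
  induction a with
  | bot => exact iff_of_true (bot_le (a := (specMap K U b).asIdeal)) bot_le
  | coe a =>
    induction b with
    | bot =>
      refine iff_of_false (fun h => ?_) (by simp)
      obtain ⟨x, hx, hx0⟩ := V_ker_ne K U
      have h' : Ideal.comap (Vmap K U) a.asIdeal ≤ ⊥ := h
      apply hx0
      have : x ∈ Ideal.comap (Vmap K U) a.asIdeal := by
        rw [Ideal.mem_comap, (RingHom.mem_ker).1 hx]; exact zero_mem _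
      simpa using h' this
    | coe b =>
      rw [WithBot.coe_le_coe]
      exact Ideal.comap_le_comap_iff_of_surjective (Vmap K U) (Vmap_surj K U) _ _

theorem specMap_surj (K : Type*) [Field K] (U : Type*) [CommRing U] [Algebra U K] :
    Function.Surjective (specMap K U) := by
  intro P
  by_cases hP : P.asIdeal = ⊥
  · exact ⟨⊥, PrimeSpectrum.ext hP.symm⟩
  · have hk := V_prime K U P.asIdeal hP
    refine ⟨((⟨P.asIdeal.map (Vmap K U),
      Ideal.map_isPrime_of_surjective (Vmap_surj K U) hk⟩ :
        PrimeSpectrum (algebraMap U K).range) : WithBot _), PrimeSpectrum.ext ?_⟩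
    change Ideal.comap (Vmap K U) (Ideal.map (Vmap K U) P.asIdeal) = _
    rw [Ideal.comap_map_of_surjective _ (Vmap_surj K U)]
    exact sup_eq_left.2 hk

theorem V_dim (K : Type*) [Field K] (U : Type*) [CommRing U] [IsDomain U]
    [Algebra U K] [IsFractionRing U K] :
    ringKrullDim (Vring K U) = ringKrullDim U + 1 := by
  let e : U ≃+* (algebraMap U K).range :=
    RingEquiv.ofBijective (algebraMap U K).rangeRestrict
      ⟨fun a b h => IsFractionRing.injective U K (congrArg Subtype.val h),
        RingHom.rangeRestrict_surjective _⟩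
  rw [ringKrullDim_eq_of_ringEquiv e, ringKrullDim, ringKrullDim, ← Order.krullDim_withBot]
  let f : WithBot (PrimeSpectrum (algebraMap U K).range) ↪o PrimeSpectrum (Vring K U) :=
    OrderEmbedding.ofMapLEIff (specMap K U) (specMap_le K U)
  exact (Order.krullDim_eq_of_orderIso (RelIso.ofSurjective f (specMap_surj K U))).symm

theorem stmt_19 (K : Type*) [Field K] (U : Type*) [CommRing U] [IsDomain U]
    [ValuationRing U] [Algebra U K] [IsFractionRing U K] :
    ValuationRing (Vring K U) ∧
      ∀ n : ℕ, ringKrullDim U = n → ringKrullDim (Vring K U) = n + 1 := by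
  refine ⟨V_val K U, fun n hn => ?_⟩
  rw [V_dim, hn]
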